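/- Let d ≥ 3 be an integer and let x be a real number with 0 < x < 1. Then ∫₀^1 v^{−1/2} (1 − v)^{(d+1)/2} (1 − xv)^{−(d/2 + 1)} · ₂F₁(1, (d−1)/2; 1/2; xv) dv = (√π · Γ((d+3)/2) / Γ(d/2 + 2)) · (1 − x)^{−(d−1)/2} · ₂F₁(1 − d/2, d/2 + 1; d/2 + 2; x). -/

import Mathlib

open Real MeasureTheory

/-- The Pochhammer symbol `(a)_n = a(a+1)⋯(a+n−1)`, with `(a)_0 = 1`. -/
noncomputable def poch (a : ℝ) (n : ℕ) : ℝ := ∏ i ∈ Finset.range n, (a + i)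

/-- The Gauss hypergeometric function `₂F₁(a,b;c;z) = Σₙ ((a)ₙ(b)ₙ/(c)ₙ) zⁿ/n!`. -/
noncomputable def hyp2F1 (a b c z : ℝ) : ℝ :=
  ∑' n : ℕ, poch a n * poch b n / poch c n * z ^ n / (n.factorial : ℝ)

lemma poch_succ (a : ℝ) (n : ℕ) : poch a (n + 1) = poch a n * (a + n) := by
  simp [poch, Finset.prod_range_succ]

lemma poch_succ_left (a : ℝ) (n : ℕ) : poch a (n + 1) = a * poch (a + 1) n := by
  induction n with
  | zero => simp [poch]
  | succ n ih => rw [poch_succ, ih, poch_succ]; push_cast; ring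

lemma poch_pos {a : ℝ} (ha : 0 < a) (n : ℕ) : 0 < poch a n :=
  Finset.prod_pos fun i _ => by positivity

lemma poch_one (n : ℕ) : poch 1 n = n.factorial := by
  induction n with
  | zero => simp [poch]
  | succ n ih => rw [poch_succ, ih, Nat.factorial_succ]; push_cast; ring

lemma poch_eq_ascPochhammer_eval (a : ℝ) (n : ℕ) : poch a n = (ascPochhammer ℝ n).eval a := by
  induction n with
  | zero => simp [poch]
  | succ n ih => rw [poch_succ, ih, ascPochhammer_succ_eval]

lemma Gamma_add_nat_eq_mul_poch {a : ℝ} (ha : 0 < a) (n : ℕ) :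
    Real.Gamma (a + n) = Real.Gamma a * poch a n := by
  induction n with
  | zero => simp [poch]
  | succ n ih =>
    rw [Nat.cast_succ, ← add_assoc, Real.Gamma_add_one (by positivity), ih, poch_succ]; ring

section FormalSeries

open PowerSeries

/-- The formal power series `∑ (s)ₙ Xⁿ / n!` of `(1 - X) ^ (-s)`. -/
noncomputable def negBinom (s : ℝ) : PowerSeries ℝ :=
  .mk fun n => poch s n / n.factorial

lemma coeff_zero_mul_eq (f g : PowerSeries ℝ) : coeff 0 (f * g) = coeff 0 f * coeff 0 g := by
  simp

lemma coeff_negBinom (s : ℝ) (n : ℕ) : coeff n (negBinom s) = poch s n / n.factorial := by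
  simp [negBinom]

lemma coeff_succ_one_sub_X_mul (f : PowerSeries ℝ) (n : ℕ) :
    coeff (n + 1) ((1 - X) * f) = coeff (n + 1) f - coeff n f := by
  rw [sub_mul, one_mul, map_sub, coeff_succ_X_mul]

lemma one_sub_X_mul_derivative_negBinom (s : ℝ) :
    (1 - X) * derivative ℝ (negBinom s) = C s * negBinom s := by
  ext n
  cases n with
  | zero =>
    rw [sub_mul, one_mul, map_sub, coeff_zero_X_mul, coeff_C_mul, coeff_derivative]
    simp [coeff_negBinom, poch, -coeff_zero_eq_constantCoeff]
  | succ n =>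
    rw [coeff_succ_one_sub_X_mul, coeff_C_mul]
    simp only [coeff_derivative, coeff_negBinom, poch_succ, Nat.factorial_succ]
    push_cast
    field_simp
    ring

lemma one_sub_X_mul_negBinom (s : ℝ) : (1 - X) * negBinom (s + 1) = negBinom s := by
  ext n
  cases n with
  | zero =>
    rw [sub_mul, one_mul, map_sub, coeff_zero_X_mul]
    simp [coeff_negBinom, poch, -coeff_zero_eq_constantCoeff]
  | succ n =>
    rw [coeff_succ_one_sub_X_mul]
    simp only [coeff_negBinom, poch_succ (s + 1), poch_succ_left s, Nat.factorial_succ]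
    push_cast
    field_simp
    ring

lemma eq_negBinom_of_ode {f : PowerSeries ℝ} {s : ℝ} (h0 : coeff 0 f = 1)
    (h : (1 - X) * derivative ℝ f = C s * f) : f = negBinom s := by
  ext n
  induction n with
  | zero => rw [h0]; simp [coeff_negBinom, poch, -coeff_zero_eq_constantCoeff]
  | succ n ih =>
    have key : coeff (n + 1) f * (n + 1) = (s + n) * coeff n f := by
      have := congrArg (coeff n) h
      cases n with
      | zero =>
        rw [sub_mul, one_mul, map_sub, coeff_zero_X_mul, coeff_C_mul, coeff_derivative] at this
        push_cast at this ⊢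
        linarith
      | succ n =>
        rw [coeff_succ_one_sub_X_mul, coeff_C_mul, coeff_derivative, coeff_derivative] at this
        push_cast at this ⊢
        linarith
    rw [ih] at key
    simp only [coeff_negBinom, poch_succ, Nat.factorial_succ] at key ⊢
    push_cast
    field_simp at key ⊢
    linarith

lemma negBinom_mul_negBinom (s t : ℝ) : negBinom s * negBinom t = negBinom (s + t) := by
  apply eq_negBinom_of_ode
  · rw [coeff_zero_mul_eq]; simp [coeff_negBinom, poch, -coeff_zero_eq_constantCoeff]
  · have hs := one_sub_X_mul_derivative_negBinom s
    have ht := one_sub_X_mul_derivative_negBinom t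
    rw [Derivation.leibniz, smul_eq_mul, smul_eq_mul, map_add]
    linear_combination negBinom s * ht + negBinom t * hs

lemma coeff_succ_of_ode {f r : PowerSeries ℝ} {p q : ℝ}
    (h : X * (1 - X) * derivative ℝ f = (C p * X + C q) * f + r) (n : ℕ) :
    (n + 1 - q) * coeff (n + 1) f = (n + p) * coeff n f + coeff (n + 1) r := by
  have := congrArg (coeff (n + 1)) h
  rw [mul_assoc, coeff_succ_X_mul, add_mul, map_add, map_add, mul_assoc, coeff_C_mul, coeff_C_mul,
    coeff_succ_X_mul] at this
  cases n with
  | zero =>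
    simp only [sub_mul, one_mul, map_sub, coeff_derivative, coeff_zero_X_mul] at this
    push_cast at this ⊢
    linarith
  | succ n =>
    rw [coeff_succ_one_sub_X_mul, coeff_derivative, coeff_derivative] at this
    push_cast at this ⊢
    linarith

/-- The formal power series of `₂F₁(a, b; c; X)`. -/
noncomputable def hypSeries (a b c : ℝ) : PowerSeries ℝ :=
  .mk fun n => poch a n * poch b n / poch c n / n.factorial

lemma coeff_hypSeries (a b c : ℝ) (n : ℕ) :
    coeff n (hypSeries a b c) = poch a n * poch b n / poch c n / n.factorial := by
  simp [hypSeries]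

lemma hypSeries_one_ode (b : ℝ) {c : ℝ} (hc : 0 < c) :
    X * (1 - X) * derivative ℝ (hypSeries 1 b c)
      = (C b * X + C (1 - c)) * hypSeries 1 b c + C (c - 1) := by
  have hF (n : ℕ) : coeff n (hypSeries 1 b c) = poch b n / poch c n := by
    rw [coeff_hypSeries, poch_one]; field_simp
  ext n
  rw [mul_assoc, add_mul, map_add, map_add, mul_assoc, coeff_C_mul, coeff_C_mul]
  rcases n with _ | _ | n
  · rw [coeff_zero_X_mul, coeff_zero_X_mul, hF, coeff_zero_C]; simp [poch]
  · rw [coeff_succ_X_mul, coeff_succ_X_mul, sub_mul, one_mul, map_sub, coeff_zero_X_mul,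
      coeff_derivative, hF, hF, coeff_C]
    simp [poch]
    field_simp
    ring
  · rw [coeff_succ_X_mul, coeff_succ_X_mul, coeff_succ_one_sub_X_mul, coeff_derivative,
      coeff_derivative, hF, hF, coeff_C]
    simp only [poch_succ]
    have := (poch_pos hc n).ne'
    push_cast
    have h1 : c + n ≠ 0 := by positivity
    have h2 : c + (n + 1) ≠ 0 := by positivity
    simp
    field_simp
    ring

lemma hypSeries_succ_ode (a : ℝ) {b : ℝ} (hb : 0 < b) :
    X * derivative ℝ (hypSeries a b (b + 1)) = C b * (negBinom a - hypSeries a b (b + 1)) := by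
  have hK (n : ℕ) : (b + n) * coeff n (hypSeries a b (b + 1)) = b * coeff n (negBinom a) := by
    rw [coeff_hypSeries, coeff_negBinom]
    have h1 := poch_succ b n
    rw [poch_succ_left] at h1
    have := (poch_pos (add_pos hb one_pos) n).ne'
    field_simp
    linear_combination - poch a n * h1
  ext n
  rw [coeff_C_mul, map_sub]
  cases n with
  | zero => have := hK 0; rw [coeff_zero_X_mul]; push_cast at this; linarith
  | succ n =>
    have := hK (n + 1); rw [coeff_succ_X_mul, coeff_derivative]; push_cast at this; linarith

lemma coeff_negBinom_mul_hypSeries {a : ℝ} (ha : 0 < a) (n : ℕ) :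
    coeff n (negBinom (a + 1) * hypSeries 1 (a - 1/2) (1/2)) * poch (1/2) n / poch (a + 2) n
      = coeff n (negBinom (a - 1/2) * hypSeries (1 - a) (a + 1) (a + 2)) := by
  set G := negBinom (a + 1) * hypSeries 1 (a - 1/2) (1/2) with hG
  set H := negBinom (a - 1/2) * hypSeries (1 - a) (a + 1) (a + 2) with hH
  have odeG : X * (1 - X) * derivative ℝ G
      = (C (2 * a + 1/2) * X + C (1/2)) * G + C (-1/2) * negBinom (a + 1) := by
    have h1 := one_sub_X_mul_derivative_negBinom (a + 1)
    have h2 := hypSeries_one_ode (a - 1/2) (c := 1/2) (by norm_num)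
    have e1 : (C (2 * a + 1/2) : PowerSeries ℝ) = C (a + 1) + C (a - 1/2) := by
      rw [← map_add]; ring_nf
    have e2 : (C (1/2 : ℝ) : PowerSeries ℝ) = C (1 - 1/2) := by norm_num
    have e3 : (C (-1/2 : ℝ) : PowerSeries ℝ) = C (1/2 - 1) := by norm_num
    rw [hG, Derivation.leibniz, smul_eq_mul, smul_eq_mul, e1, e2, e3]
    linear_combination X * hypSeries 1 (a - 1/2) (1/2) * h1 + negBinom (a + 1) * h2
  have odeH : X * (1 - X) * derivative ℝ H
      = (C (2 * a + 1/2) * X + C (-(a + 1))) * H + C (a + 1) * negBinom (-1/2) := by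
    have h1 := one_sub_X_mul_derivative_negBinom (a - 1/2)
    have h2 := hypSeries_succ_ode (1 - a) (b := a + 1) (by linarith)
    have h3 := negBinom_mul_negBinom (a - 1/2) (1 - a)
    have h4 := one_sub_X_mul_negBinom (-1/2)
    rw [show a - 1/2 + (1 - a) = -1/2 + 1 by ring] at h3
    rw [show a + 1 + 1 = a + 2 by ring] at h2
    have e1 : (C (2 * a + 1/2) : PowerSeries ℝ) = C (a + 1) + C (a - 1/2) := by
      rw [← map_add]; ring_nf
    rw [hH, Derivation.leibniz, smul_eq_mul, smul_eq_mul, e1, map_neg]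
    linear_combination X * hypSeries (1 - a) (a + 1) (a + 2) * h1
      + (1 - X) * negBinom (a - 1/2) * h2 + C (a + 1) * (1 - X) * h3 + C (a + 1) * h4
  induction n with
  | zero =>
    rw [hG, hH, coeff_zero_mul_eq, coeff_zero_mul_eq]
    simp [coeff_negBinom, coeff_hypSeries, poch, -coeff_zero_eq_constantCoeff]
  | succ n ih =>
    have rG := coeff_succ_of_ode odeG n
    have rH := coeff_succ_of_ode odeH n
    rw [coeff_C_mul, coeff_negBinom] at rG rH
    rw [← ih, poch_succ_left (-1/2), show (-1/2 : ℝ) + 1 = 1/2 by norm_num] at rH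
    rw [poch_succ_left (a + 1), show a + 1 + 1 = a + 2 by ring] at rG
    have hp := (poch_pos (show 0 < a + 2 by linarith) n).ne'
    have hq : (n : ℝ) + 1 + (a + 1) ≠ 0 := by positivity
    have hq' : a + 2 + (n : ℝ) ≠ 0 := by positivity
    apply mul_left_cancel₀ (show (n : ℝ) + 1 - -(a + 1) ≠ 0 by rwa [sub_neg_eq_add])
    rw [rH, poch_succ, poch_succ]
    have rG' : (1/2 + (n : ℝ)) * coeff (n + 1) G = (n + (2 * a + 1/2)) * coeff n G
        + -1/2 * ((a + 1) * poch (a + 2) n / ((n + 1).factorial : ℝ)) := by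
      rw [← rG]; ring
    have hf : ((n + 1).factorial : ℝ) ≠ 0 := by positivity
    field_simp at rG' ⊢
    linear_combination (poch (1/2) n * (a + 2 + n)) * rG'

end FormalSeries

lemma sum_antidiagonal_mul_pow (f g : PowerSeries ℝ) (z : ℝ) (n : ℕ) :
    ∑ p ∈ Finset.HasAntidiagonal.antidiagonal n,
        (f.coeff p.1 * z ^ p.1) * (g.coeff p.2 * z ^ p.2) = (f * g).coeff n * z ^ n := by
  rw [PowerSeries.coeff_mul, Finset.sum_mul]
  refine Finset.sum_congr rfl fun p hp => ?_
  rw [← Finset.HasAntidiagonal.mem_antidiagonal.mp hp, pow_add]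
  ring

lemma summable_norm_coeff_mul {f g : PowerSeries ℝ} {z : ℝ}
    (hf : Summable fun n => ‖f.coeff n * z ^ n‖) (hg : Summable fun n => ‖g.coeff n * z ^ n‖) :
    Summable fun n => ‖(f * g).coeff n * z ^ n‖ := by
  simpa only [sum_antidiagonal_mul_pow] using
    summable_norm_sum_mul_antidiagonal_of_summable_norm hf hg

lemma tsum_coeff_mul {f g : PowerSeries ℝ} {z : ℝ}
    (hf : Summable fun n => ‖f.coeff n * z ^ n‖) (hg : Summable fun n => ‖g.coeff n * z ^ n‖) :
    ∑' n, (f * g).coeff n * z ^ n = (∑' n, f.coeff n * z ^ n) * ∑' n, g.coeff n * z ^ n := by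
  simpa only [sum_antidiagonal_mul_pow] using
    (tsum_mul_tsum_eq_tsum_sum_antidiagonal_of_summable_norm hf hg).symm

lemma coeff_negBinom_eq_choose (s : ℝ) (n : ℕ) :
    (negBinom s).coeff n = Ring.choose (s + n - 1) n := by
  have h := Ring.factorial_nsmul_multichoose_eq_ascPochhammer s n
  rw [Polynomial.ascPochhammer_smeval_eq_eval, ← poch_eq_ascPochhammer_eval, nsmul_eq_mul,
    Ring.multichoose_eq] at h
  rw [coeff_negBinom, ← h]
  field_simp

lemma summable_norm_negBinom (s : ℝ) {z : ℝ} (hz : |z| < 1) :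
    Summable fun n => ‖(negBinom s).coeff n * z ^ n‖ := by
  have h := Real.one_div_one_sub_rpow_hasFPowerSeriesOnBall_zero s
  have hz' : z ∈ Metric.eball (0 : ℝ) 1 := by
    simpa [← ENNReal.ofReal_one, Metric.eball_ofReal] using hz
  have := FormalMultilinearSeries.summable_norm_apply _ (Metric.eball_subset_eball h.r_le hz')
  simpa [coeff_negBinom_eq_choose, FormalMultilinearSeries.ofScalars, mul_comm] using this

lemma tsum_negBinom (s : ℝ) {z : ℝ} (hz : |z| < 1) :
    ∑' n, (negBinom s).coeff n * z ^ n = (1 - z) ^ (-s) := by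
  have h := Real.one_div_one_sub_rpow_hasFPowerSeriesOnBall_zero s
  have hz' : z ∈ Metric.eball (0 : ℝ) 1 := by
    simpa [← ENNReal.ofReal_one, Metric.eball_ofReal] using hz
  have := (h.hasSum hz').tsum_eq
  rw [Real.rpow_neg (by linarith [(abs_lt.mp hz).2])]
  simpa [coeff_negBinom_eq_choose, FormalMultilinearSeries.ofScalars, mul_comm] using this

lemma hyp2F1_eq_tsum_coeff (a b c z : ℝ) :
    hyp2F1 a b c z = ∑' n, (hypSeries a b c).coeff n * z ^ n := by
  simp only [hyp2F1, coeff_hypSeries, div_mul_eq_mul_div]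

lemma summable_norm_hypSeries_one {b c : ℝ} (hb : 0 < b) (hc : 0 < c) {z : ℝ} (hz : |z| < 1) :
    Summable fun n => ‖(hypSeries 1 b c).coeff n * z ^ n‖ := by
  rcases eq_or_ne z 0 with rfl | hz0
  · exact summable_of_ne_finset_zero (s := {0}) fun n hn => by
      simp [zero_pow (by simpa using hn : n ≠ 0)]
  have hF (n : ℕ) : (hypSeries 1 b c).coeff n = poch b n / poch c n := by
    rw [coeff_hypSeries, poch_one]; field_simp
  refine Summable.norm (summable_of_ratio_test_tendsto_lt_one hz (.of_forall fun n => ?_) ?_)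
  · rw [hF]
    have := poch_pos hb n
    have := poch_pos hc n
    positivity
  · have hlim : Filter.Tendsto (fun n : ℕ => (b + n) / (c + n) * |z|) Filter.atTop (nhds |z|) := by
      have := (tendsto_add_mul_div_add_mul_atTop_nhds b c (1 : ℝ) one_ne_zero).mul_const |z|
      simpa using this
    refine hlim.congr fun n => ?_
    have h1 := poch_pos hb n
    have h2 := poch_pos hc n
    have h3 : 0 < |z| := by positivity
    rw [hF, hF, poch_succ, poch_succ, norm_mul, norm_mul, norm_pow, norm_pow, Real.norm_eq_abs z,
      Real.norm_of_nonneg (by positivity), Real.norm_of_nonneg (by positivity), pow_succ]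
    field_simp

lemma summable_norm_hypSeries_succ (a : ℝ) {b : ℝ} (hb : 0 < b) {z : ℝ} (hz : |z| < 1) :
    Summable fun n => ‖(hypSeries a b (b + 1)).coeff n * z ^ n‖ := by
  refine (summable_norm_negBinom a hz).of_nonneg_of_le (fun _ => norm_nonneg _) fun n => ?_
  have hle : poch b n ≤ poch (b + 1) n :=
    Finset.prod_le_prod (fun i _ => by positivity) fun i _ => by linarith
  have h1 := poch_pos hb n
  have h2 := poch_pos (add_pos hb one_pos) n
  rw [norm_mul, norm_mul]
  gcongr
  rw [show (hypSeries a b (b + 1)).coeff n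
      = (negBinom a).coeff n * (poch b n / poch (b + 1) n) by
    rw [coeff_hypSeries, coeff_negBinom]; ring, norm_mul,
    Real.norm_of_nonneg (r := poch b n / _) (by positivity)]
  exact mul_le_of_le_one_right (norm_nonneg _) (div_le_one_of_le₀ hle h2.le)

lemma ofReal_beta_integrand {p q t : ℝ} (ht : t ∈ Set.Ioc (0 : ℝ) 1) :
    ((t : ℂ) ^ ((p : ℂ) - 1) * (1 - (t : ℂ)) ^ ((q : ℂ) - 1))
      = ((t ^ (p - 1) * (1 - t) ^ (q - 1) : ℝ) : ℂ) := by
  rw [Complex.ofReal_mul, Complex.ofReal_cpow ht.1.le, Complex.ofReal_cpow (sub_nonneg.mpr ht.2)]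
  push_cast
  rfl

lemma intervalIntegrable_beta_integrand {p q : ℝ} (hp : 0 < p) (hq : 0 < q) :
    IntervalIntegrable (fun t : ℝ => t ^ (p - 1) * (1 - t) ^ (q - 1)) volume 0 1 := by
  have h := Complex.betaIntegral_convergent (u := p) (v := q) (by simpa) (by simpa)
  rw [intervalIntegrable_iff, Set.uIoc_of_le zero_le_one] at h ⊢
  refine (MeasureTheory.Integrable.re h).congr ?_
  filter_upwards [ae_restrict_mem measurableSet_Ioc] with t ht
  rw [ofReal_beta_integrand ht]
  simp

lemma integral_beta_integrand {p q : ℝ} (hp : 0 < p) (hq : 0 < q) :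
    ∫ t in (0:ℝ)..1, t ^ (p - 1) * (1 - t) ^ (q - 1)
      = Real.Gamma p * Real.Gamma q / Real.Gamma (p + q) := by
  have h := Complex.betaIntegral_eq_Gamma_mul_div p q (by simpa) (by simpa)
  rw [Complex.betaIntegral, intervalIntegral.integral_congr_ae (g := fun t : ℝ =>
    ((t ^ (p - 1) * (1 - t) ^ (q - 1) : ℝ) : ℂ)) (.of_forall fun t ht =>
      ofReal_beta_integrand (by rwa [Set.uIoc_of_le zero_le_one] at ht)),
    intervalIntegral.integral_ofReal, ← Complex.ofReal_add, Complex.Gamma_ofReal,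
    Complex.Gamma_ofReal, Complex.Gamma_ofReal] at h
  exact_mod_cast h

lemma hasSum_integral_beta_mul_pow {p q : ℝ} (hp : 0 < p) (hq : 0 < q) {f : PowerSeries ℝ} {x : ℝ}
    (hf : Summable fun n => ‖f.coeff n * x ^ n‖) :
    HasSum (fun n : ℕ => f.coeff n * x ^ n
        * (Real.Gamma (p + n) * Real.Gamma q / Real.Gamma (p + n + q)))
      (∫ v in (0:ℝ)..1, v ^ (p - 1) * (1 - v) ^ (q - 1) * ∑' n, f.coeff n * (x * v) ^ n) := by
  have hbeta := intervalIntegrable_beta_integrand hp hq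
  have hbound (n : ℕ) {v : ℝ} (hv : v ∈ Set.Ioc (0 : ℝ) 1) :
      ‖f.coeff n * (x * v) ^ n‖ ≤ ‖f.coeff n * x ^ n‖ := by
    rw [mul_pow, ← mul_assoc, norm_mul _ (v ^ n), norm_pow, Real.norm_of_nonneg hv.1.le]
    exact mul_le_of_le_one_right (norm_nonneg _) (pow_le_one₀ hv.1.le hv.2)
  have hI : (fun n : ℕ => f.coeff n * x ^ n
        * (Real.Gamma (p + n) * Real.Gamma q / Real.Gamma (p + n + q)))
      = fun n : ℕ => ∫ v in (0:ℝ)..1,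
          v ^ (p - 1) * (1 - v) ^ (q - 1) * (f.coeff n * (x * v) ^ n) := by
    funext n
    rw [← integral_beta_integrand (by positivity) hq, ← intervalIntegral.integral_const_mul]
    refine intervalIntegral.integral_congr_ae (.of_forall fun v hv => ?_)
    rw [Set.uIoc_of_le zero_le_one] at hv
    rw [add_sub_right_comm, Real.rpow_add_natCast hv.1.ne', mul_pow]
    ring
  rw [hI]
  refine intervalIntegral.hasSum_integral_of_dominated_convergence
    (fun n v => v ^ (p - 1) * (1 - v) ^ (q - 1) * ‖f.coeff n * x ^ n‖) (fun n => ?_)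
    (fun n => .of_forall fun v hv => ?_) (.of_forall fun v _ => hf.mul_left _) ?_
    (.of_forall fun v hv => ?_)
  · rw [Set.uIoc_of_le zero_le_one]
    have := ((intervalIntegrable_iff_integrableOn_Ioc_of_le zero_le_one).mp hbeta).1
    exact this.mul (by fun_prop)
  · rw [Set.uIoc_of_le zero_le_one] at hv
    have h0 : 0 ≤ v ^ (p - 1) * (1 - v) ^ (q - 1) :=
      mul_nonneg (Real.rpow_nonneg hv.1.le _) (Real.rpow_nonneg (sub_nonneg.mpr hv.2) _)
    rw [norm_mul, Real.norm_of_nonneg h0]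
    exact mul_le_mul_of_nonneg_left (hbound n hv) h0
  · simp_rw [tsum_mul_left]
    exact hbeta.mul_const _
  · rw [Set.uIoc_of_le zero_le_one] at hv
    exact ((hf.of_nonneg_of_le (fun _ => norm_nonneg _) (hbound · hv)).of_norm.hasSum).mul_left _

/-- For an integer `d ≥ 3` and `0 < x < 1`,
`∫₀¹ v^{−1/2} (1−v)^{(d+1)/2} (1−xv)^{−(d/2+1)} ₂F₁(1,(d−1)/2;1/2;xv) dv
  = (√π Γ((d+3)/2)/Γ(d/2+2)) (1−x)^{−(d−1)/2} ₂F₁(1−d/2,d/2+1;d/2+2;x)`. -/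
theorem hyp2F1_integral_J (d : ℕ) (hd : 3 ≤ d) (x : ℝ) (h0 : 0 < x) (h1 : x < 1) :
    (∫ v in (0:ℝ)..1, v ^ (-(1:ℝ)/2) * (1 - v) ^ (((d:ℝ) + 1)/2)
        * (1 - x * v) ^ (-((d:ℝ)/2 + 1))
        * hyp2F1 1 (((d:ℝ) - 1)/2) (1/2) (x * v))
      = Real.sqrt π * Real.Gamma (((d:ℝ) + 3)/2) / Real.Gamma ((d:ℝ)/2 + 2)
        * (1 - x) ^ (-(((d:ℝ) - 1)/2))
        * hyp2F1 (1 - (d:ℝ)/2) ((d:ℝ)/2 + 1) ((d:ℝ)/2 + 2) x := by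
  set a : ℝ := (d : ℝ) / 2 with ha
  have hd' : (3 : ℝ) ≤ d := by exact_mod_cast hd
  have ha0 : 0 < a := by linarith
  have hx : |x| < 1 := by rwa [abs_of_pos h0]
  have hb : ((d : ℝ) - 1) / 2 = a - 1/2 := by rw [ha]; ring
  rw [hb, show ((d : ℝ) + 1) / 2 = (a + 3/2) - 1 by rw [ha]; ring,
    show ((d : ℝ) + 3) / 2 = a + 3/2 by rw [ha]; ring, show (-(1:ℝ)/2) = 1/2 - 1 by norm_num]
  set G := negBinom (a + 1) * hypSeries 1 (a - 1/2) (1/2) with hG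
  have hint : ∀ v ∈ Set.uIoc (0 : ℝ) 1,
      v ^ ((1/2 : ℝ) - 1) * (1 - v) ^ (a + 3/2 - 1) * (1 - x * v) ^ (-(a + 1))
        * hyp2F1 1 (a - 1/2) (1/2) (x * v)
      = v ^ ((1/2 : ℝ) - 1) * (1 - v) ^ (a + 3/2 - 1) * ∑' n, G.coeff n * (x * v) ^ n := by
    intro v hv
    rw [Set.uIoc_of_le zero_le_one] at hv
    have hxv : |x * v| < 1 := by
      rw [abs_of_pos (mul_pos h0 hv.1)]
      exact (mul_le_of_le_one_right h0.le hv.2).trans_lt h1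
    rw [hG, tsum_coeff_mul (summable_norm_negBinom _ hxv)
      (summable_norm_hypSeries_one (by linarith) (by norm_num) hxv), tsum_negBinom _ hxv,
      ← hyp2F1_eq_tsum_coeff, mul_assoc _ (_ ^ _) (hyp2F1 _ _ _ _)]
  rw [intervalIntegral.integral_congr_ae (.of_forall hint)]
  have hsum := hasSum_integral_beta_mul_pow (p := 1/2) (q := a + 3/2) (by norm_num) (by linarith)
    (summable_norm_coeff_mul (summable_norm_negBinom (a + 1) hx)
      (summable_norm_hypSeries_one (b := a - 1/2) (c := 1/2) (by linarith) (by norm_num) hx))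
  have hK := summable_norm_hypSeries_succ (1 - a) (b := a + 1) (by linarith) hx
  rw [show a + 1 + 1 = a + 2 by ring] at hK
  rw [← hsum.tsum_eq, ← tsum_negBinom _ hx, hyp2F1_eq_tsum_coeff, mul_assoc,
    ← tsum_coeff_mul (summable_norm_negBinom _ hx) hK, ← tsum_mul_left]
  refine tsum_congr fun n => ?_
  rw [← coeff_negBinom_mul_hypSeries ha0, Gamma_add_nat_eq_mul_poch (by norm_num),
    show 1/2 + (n : ℝ) + (a + 3/2) = a + 2 + n by ring,
    Gamma_add_nat_eq_mul_poch (by linarith), Real.Gamma_one_half_eq]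
  field_simp
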